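/- arXiv:1207.6383 — 2 statements merged into one kernel-verified Lean document; each statement's English description precedes it below -/
import Mathlib

section
/- Let G be a group with commutator subgroup G' = G (i.e., G is perfect), and m, n positive integers with m, n ≥ 1. Then for every index pair (i, j) and every g ∈ G, the matrix in G^{m×n} with g at position (i,j) and identity elsewhere lies in the subgroup generated by all row moves and column moves. -/
def rowMove {G : Type*} [Group G] (m n : ℕ) (r : G) (i : Fin m) : Fin m → Fin n → G :=
  fun i' _ => if i' = i then r else 1

def colMove {G : Type*} [Group G] (m n : ℕ) (c : G) (j : Fin n) : Fin m → Fin n → G :=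
  fun _ j' => if j' = j then c else 1

theorem perfect_group_single_entry_in_closure
    {G : Type*} [Group G] (hperf : commutator G = ⊤)
    (m n : ℕ) (hm : 1 ≤ m) (hn : 1 ≤ n) (i : Fin m) (j : Fin n) (g : G) :
    (fun i' j' => if i' = i ∧ j' = j then g else 1) ∈
      Subgroup.closure ({f | ∃ r i, f = rowMove m n r i} ∪
        {f | ∃ c j, f = colMove m n c j} : Set (Fin m → Fin n → G)) := by
  have hg : g ∈ commutator G := by rw [hperf]; trivial
  rw [commutator_eq_closure] at hg
  induction hg using Subgroup.closure_induction with
  | mem x hx =>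
    obtain ⟨a, b, rfl⟩ := hx
    have ha : rowMove m n a i ∈ Subgroup.closure ({f | ∃ r i, f = rowMove m n r i} ∪
        {f | ∃ c j, f = colMove m n c j} : Set (Fin m → Fin n → G)) :=
      Subgroup.subset_closure (Or.inl ⟨a, i, rfl⟩)
    have hb : colMove m n b j ∈ Subgroup.closure ({f | ∃ r i, f = rowMove m n r i} ∪
        {f | ∃ c j, f = colMove m n c j} : Set (Fin m → Fin n → G)) :=
      Subgroup.subset_closure (Or.inr ⟨b, j, rfl⟩)
    convert mul_mem (mul_mem (mul_mem ha hb) (inv_mem ha)) (inv_mem hb) using 1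
    funext i' j'
    by_cases h1 : i' = i <;> by_cases h2 : j' = j <;>
      simp [rowMove, colMove, h1, h2, commutatorElement_def]
  | one =>
    convert Subgroup.one_mem _ using 1
    funext i' j'
    simp
  | mul x y _ _ hx hy =>
    convert mul_mem hx hy using 1
    funext i' j'
    by_cases h : i' = i ∧ j' = j <;> simp [h]
  | inv x _ hx =>
    convert inv_mem hx using 1
    funext i' j'
    by_cases h : i' = i ∧ j' = j <;> simp [h]
end

section
/- A configuration (g_{ij}) ∈ S_4^{m×n} lies in the picture cube puzzle group H (generated by right multiplication of rows by u = (1 4 2 3) or d = (1 3 2 4) and of columns by l = (1 3 4 2) or r = (1 2 4 3)) if and only if sgn(g_{ij}) = sgn(g_{1j}) · sgn(g_{i1}) · sgn(g_{11}) for all i, j. -/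
def cubeU : Equiv.Perm (Fin 4) := c[(0 : Fin 4), 3, 1, 2]
def cubeD : Equiv.Perm (Fin 4) := c[(0 : Fin 4), 2, 1, 3]
def cubeL : Equiv.Perm (Fin 4) := c[(0 : Fin 4), 2, 3, 1]
def cubeR : Equiv.Perm (Fin 4) := c[(0 : Fin 4), 1, 3, 2]

def cubeMoves (m n : ℕ) : Set (Fin m → Fin n → Equiv.Perm (Fin 4)) :=
  {f | ∃ i, f = rowMove m n cubeU i ∨ f = rowMove m n cubeD i} ∪
  {f | ∃ j, f = colMove m n cubeL j ∨ f = colMove m n cubeR j}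

theorem cube_even_decomp : ∀ x : Equiv.Perm (Fin 4), Equiv.Perm.sign x = 1 →
    ∃ a b : Fin 4, ∃ e f : Fin 3,
      x = (cubeU ^ (a : ℕ) * (cubeU * cubeL * cubeU⁻¹ * cubeL⁻¹) ^ (e : ℕ) * (cubeU ^ (a : ℕ))⁻¹) *
        (cubeU ^ (b : ℕ) * (cubeU * cubeL * cubeU⁻¹ * cubeL⁻¹) ^ (f : ℕ) *
          (cubeU ^ (b : ℕ))⁻¹) := by
  decide +kernel

theorem cube_sign_U : Equiv.Perm.sign cubeU = -1 := by decide +kernel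
theorem cube_sign_D : Equiv.Perm.sign cubeD = -1 := by decide +kernel
theorem cube_sign_L : Equiv.Perm.sign cubeL = -1 := by decide +kernel
theorem cube_sign_R : Equiv.Perm.sign cubeR = -1 := by decide +kernel

theorem cube_rowU_mem (m n : ℕ) (i : Fin m) :
    rowMove m n cubeU i ∈ Subgroup.closure (cubeMoves m n) :=
  Subgroup.subset_closure (Or.inl ⟨i, Or.inl rfl⟩)

theorem cube_colL_mem (m n : ℕ) (j : Fin n) :
    colMove m n cubeL j ∈ Subgroup.closure (cubeMoves m n) :=
  Subgroup.subset_closure (Or.inr ⟨j, Or.inl rfl⟩)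

/-- The embedding of `S_4` at the entry `(i, j)`. -/
def cubeSingle (m n : ℕ) (i : Fin m) (j : Fin n) :
    Equiv.Perm (Fin 4) →* (Fin m → Fin n → Equiv.Perm (Fin 4)) :=
  (MonoidHom.mulSingle (fun _ : Fin m => Fin n → Equiv.Perm (Fin 4)) i).comp
    (MonoidHom.mulSingle (fun _ : Fin n => Equiv.Perm (Fin 4)) j)

theorem cubeSingle_apply (m n : ℕ) (i : Fin m) (j : Fin n) (x : Equiv.Perm (Fin 4))
    (i' : Fin m) (j' : Fin n) :
    cubeSingle m n i j x i' j' = if i' = i ∧ j' = j then x else 1 := by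
  by_cases h : i' = i
  · subst h
    by_cases h2 : j' = j
    · subst h2; simp [cubeSingle]
    · simp [cubeSingle, h2]
  · simp [cubeSingle, h]

theorem cube_single_comm (m n : ℕ) (i : Fin m) (j : Fin n) :
    cubeSingle m n i j (cubeU * cubeL * cubeU⁻¹ * cubeL⁻¹) =
      rowMove m n cubeU i * colMove m n cubeL j * (rowMove m n cubeU i)⁻¹ *
        (colMove m n cubeL j)⁻¹ := by
  funext i' j'
  rw [cubeSingle_apply]
  simp only [Pi.mul_apply, Pi.inv_apply, rowMove, colMove]
  by_cases h : i' = i <;> by_cases h2 : j' = j <;> simp [h, h2]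

theorem cube_single_conj (m n : ℕ) (i : Fin m) (j : Fin n) (a : ℕ) (x : Equiv.Perm (Fin 4)) :
    cubeSingle m n i j (cubeU ^ a * x * (cubeU ^ a)⁻¹) =
      rowMove m n cubeU i ^ a * cubeSingle m n i j x * (rowMove m n cubeU i ^ a)⁻¹ := by
  funext i' j'
  simp only [Pi.mul_apply, Pi.inv_apply, Pi.pow_apply, cubeSingle_apply, rowMove]
  by_cases h : i' = i <;> by_cases h2 : j' = j <;> simp [h, h2]

theorem cube_single_mem (m n : ℕ) (i : Fin m) (j : Fin n) (x : Equiv.Perm (Fin 4))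
    (hx : Equiv.Perm.sign x = 1) :
    cubeSingle m n i j x ∈ Subgroup.closure (cubeMoves m n) := by
  have key : ∀ a e : ℕ, cubeSingle m n i j
      (cubeU ^ a * (cubeU * cubeL * cubeU⁻¹ * cubeL⁻¹) ^ e * (cubeU ^ a)⁻¹) ∈
        Subgroup.closure (cubeMoves m n) := by
    intro a e
    have hU := cube_rowU_mem m n i
    have hL := cube_colL_mem m n j
    rw [cube_single_conj, map_pow, cube_single_comm]
    refine mul_mem (mul_mem (pow_mem hU _) (pow_mem ?_ _)) (inv_mem (pow_mem hU _))
    exact mul_mem (mul_mem (mul_mem hU hL) (inv_mem hU)) (inv_mem hL)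
  obtain ⟨a, b, e, f, h⟩ := cube_even_decomp x hx
  rw [h, map_mul]
  exact mul_mem (key _ _) (key _ _)

theorem cube_even_mem (m n : ℕ) (g : Fin m → Fin n → Equiv.Perm (Fin 4))
    (hg : ∀ i j, Equiv.Perm.sign (g i j) = 1) : g ∈ Subgroup.closure (cubeMoves m n) := by
  refine Subgroup.pi_mem_of_mulSingle_mem g fun i => ?_
  have : g i ∈ (Subgroup.closure (cubeMoves m n)).comap
      (MonoidHom.mulSingle (fun _ : Fin m => Fin n → Equiv.Perm (Fin 4)) i) := by
    refine Subgroup.pi_mem_of_mulSingle_mem (g i) fun j => ?_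
    exact cube_single_mem m n i j (g i j) (hg i j)
  exact this

/-- Configurations with constant rows. -/
def cubeRows (m n : ℕ) :
    (Fin m → Equiv.Perm (Fin 4)) →* (Fin m → Fin n → Equiv.Perm (Fin 4)) where
  toFun r := fun i _ => r i
  map_one' := rfl
  map_mul' _ _ := rfl

/-- Configurations with constant columns. -/
def cubeCols (m n : ℕ) :
    (Fin n → Equiv.Perm (Fin 4)) →* (Fin m → Fin n → Equiv.Perm (Fin 4)) where
  toFun c := fun _ j => c j
  map_one' := rfl
  map_mul' _ _ := rfl

theorem cube_rows_mem (m n : ℕ) (r : Fin m → Equiv.Perm (Fin 4))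
    (hr : ∀ i, r i = 1 ∨ r i = cubeU) :
    cubeRows m n r ∈ Subgroup.closure (cubeMoves m n) := by
  have : r ∈ (Subgroup.closure (cubeMoves m n)).comap (cubeRows m n) := by
    refine Subgroup.pi_mem_of_mulSingle_mem r fun i => ?_
    rcases hr i with h | h
    · rw [h, Pi.mulSingle_one]; exact one_mem _
    · rw [h, Subgroup.mem_comap]
      convert cube_rowU_mem m n i using 1
      funext i' j'
      simp [cubeRows, rowMove, Pi.mulSingle_apply]
  exact this

theorem cube_cols_mem (m n : ℕ) (c : Fin n → Equiv.Perm (Fin 4))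
    (hc : ∀ j, c j = 1 ∨ c j = cubeL) :
    cubeCols m n c ∈ Subgroup.closure (cubeMoves m n) := by
  have : c ∈ (Subgroup.closure (cubeMoves m n)).comap (cubeCols m n) := by
    refine Subgroup.pi_mem_of_mulSingle_mem c fun j => ?_
    rcases hc j with h | h
    · rw [h, Pi.mulSingle_one]; exact one_mem _
    · rw [h, Subgroup.mem_comap]
      convert cube_colL_mem m n j using 1
      funext i' j'
      simp [cubeCols, colMove, Pi.mulSingle_apply]
  exact this

theorem cube_exists_sign (v : Equiv.Perm (Fin 4)) (hv : Equiv.Perm.sign v = -1) (s : ℤˣ) :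
    ∃ x : Equiv.Perm (Fin 4), (x = 1 ∨ x = v) ∧ Equiv.Perm.sign x = s := by
  rcases Int.units_eq_one_or s with h | h
  · exact ⟨1, Or.inl rfl, by simp [h]⟩
  · exact ⟨v, Or.inr rfl, by rw [hv, h]⟩

theorem cube_puzzle_solvability_criterion (m n : ℕ) (hm : 0 < m) (hn : 0 < n)
    (g : Fin m → Fin n → Equiv.Perm (Fin 4)) :
    g ∈ Subgroup.closure (cubeMoves m n) ↔
      ∀ i j, Equiv.Perm.sign (g i j) =
        Equiv.Perm.sign (g ⟨0, hm⟩ j) * Equiv.Perm.sign (g i ⟨0, hn⟩) *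
          Equiv.Perm.sign (g ⟨0, hm⟩ ⟨0, hn⟩) := by
  constructor
  · intro h
    induction h using Subgroup.closure_induction with
    | mem x hx =>
      intro i j
      rcases hx with ⟨k, rfl | rfl⟩ | ⟨k, rfl | rfl⟩ <;>
        simp only [rowMove, colMove] <;> split_ifs <;>
        simp [cube_sign_U, cube_sign_D, cube_sign_L, cube_sign_R]
    | one => intro i j; simp
    | mul x y _ _ hx hy =>
      intro i j
      simp only [Pi.mul_apply, Equiv.Perm.sign_mul]
      rw [hx i j, hy i j]
      ac_rfl
    | inv x _ hx =>
      intro i j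
      simp only [Pi.inv_apply, Equiv.Perm.sign_inv]
      exact hx i j
  · intro h
    choose r hr hrs using fun i : Fin m => cube_exists_sign cubeU cube_sign_U
      (Equiv.Perm.sign (g i ⟨0, hn⟩) * Equiv.Perm.sign (g ⟨0, hm⟩ ⟨0, hn⟩))
    choose c hc hcs using fun j : Fin n => cube_exists_sign cubeL cube_sign_L
      (Equiv.Perm.sign (g ⟨0, hm⟩ j))
    have hR := cube_rows_mem m n r hr
    have hC := cube_cols_mem m n c hc
    have hE : (cubeRows m n r)⁻¹ * g * (cubeCols m n c)⁻¹ ∈ Subgroup.closure (cubeMoves m n) := by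
      refine cube_even_mem m n _ fun i j => ?_
      have e1 : cubeRows m n r i j = r i := rfl
      have e2 : cubeCols m n c i j = c j := rfl
      simp only [Pi.mul_apply, Pi.inv_apply, e1, e2, Equiv.Perm.sign_mul, Equiv.Perm.sign_inv,
        hrs, hcs]
      rw [h i j]
      generalize Equiv.Perm.sign (g ⟨0, hm⟩ j) = a
      generalize Equiv.Perm.sign (g i ⟨0, hn⟩) = b
      generalize Equiv.Perm.sign (g ⟨0, hm⟩ ⟨0, hn⟩) = d
      rcases Int.units_eq_one_or a with rfl | rfl <;> rcases Int.units_eq_one_or b with rfl | rfl <;>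
        rcases Int.units_eq_one_or d with rfl | rfl <;> rfl
    have : g = cubeRows m n r * ((cubeRows m n r)⁻¹ * g * (cubeCols m n c)⁻¹) *
        cubeCols m n c := by group
    rw [this]
    exact mul_mem (mul_mem hR hE) hC
end
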